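/- arXiv:2006.08138 — 5 statements merged into one kernel-verified Lean document; each statement's English description precedes it below -/
import Mathlib

section
/- Let (Z, 𝒜, P) be a probability space, M > 0, F a countable nonempty set of measurable functions f : Z → [0, M], and φ : ℝ → ℝ a disutility function that is Lipschitz with constant L. For every n ≥ 1 and δ ∈ (0,1], the n-fold product measure P^n of the set of samples (z₁,...,zₙ) ∈ Z^n on which the following holds is at least 1 − δ: every f̂ ∈ F attaining the minimum of IOCE_φ(·;P_n) over F satisfies IOCE_φ(f̂;P) ≤ inf_{f∈F} IOCE_φ(f;P) + L·( 4·E_{P^n}[Rad_n(F(Z^n))] + 2M·(2 + √(log(2/δ)))/√n ), where P_n is the empirical measure of (z₁,...,zₙ). -/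
open MeasureTheory Finset Set ENNReal

/-- A disutility function: nondecreasing, convex, `φ(0) = 0`, and `1 ∈ ∂φ(0)` (i.e. `φ(t) ≥ t`). -/
def IsDisutility (φ : ℝ → ℝ) : Prop :=
  Monotone φ ∧ ConvexOn ℝ Set.univ φ ∧ φ 0 = 0 ∧ ∀ t : ℝ, t ≤ φ t

/-- The optimized certainty equivalent risk `OCE_φ(f;Q) = inf_λ (λ + ∫ φ(f − λ) dQ)`. -/
noncomputable def OCE {Z : Type*} [MeasurableSpace Z] (φ : ℝ → ℝ) (f : Z → ℝ) (Q : Measure Z) : ℝ :=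
  ⨅ lam : ℝ, (lam + ∫ z, φ (f z - lam) ∂Q)

/-- The inverted OCE risk `IOCE_φ(f;Q) = sup_λ (λ − ∫ φ(λ − f) dQ)`. -/
noncomputable def IOCE {Z : Type*} [MeasurableSpace Z] (φ : ℝ → ℝ) (f : Z → ℝ) (Q : Measure Z) : ℝ :=
  ⨆ lam : ℝ, (lam - ∫ z, φ (lam - f z) ∂Q)

/-- The empirical measure `(1/n)·Σᵢ δ_{zᵢ}` of a sample `z : Fin n → Z`. -/
noncomputable def empMeas {Z : Type*} [MeasurableSpace Z] {n : ℕ} (z : Fin n → Z) : Measure Z :=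
  (n : ℝ≥0∞)⁻¹ • ∑ i : Fin n, Measure.dirac (z i)

/-- The Rademacher average of a function class `F` on a sample `z`:
`2^{-n}·Σ_{ε ∈ {−1,1}ⁿ} sup_{f∈F} (1/n)·Σᵢ εᵢ f(zᵢ)`. -/
noncomputable def rad {Z : Type*} {n : ℕ} (F : Set (Z → ℝ)) (z : Fin n → Z) : ℝ :=
  (2 ^ n : ℝ)⁻¹ * ∑ ε : Fin n → Bool,
    ⨆ f : F, (n : ℝ)⁻¹ * ∑ i : Fin n, (if ε i then (1 : ℝ) else -1) * (f : Z → ℝ) (z i)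

open ProbabilityTheory

theorem integral_pi_fin_succ {Z : Type*} [MeasurableSpace Z] (P : Measure Z)
    [IsProbabilityMeasure P] {n : ℕ} (g : (Fin (n + 1) → Z) → ℝ) :
    ∫ z, g z ∂(Measure.pi fun _ : Fin (n + 1) => P) =
      ∫ p : Z × (Fin n → Z), g (Fin.cons p.1 p.2) ∂(P.prod (Measure.pi fun _ : Fin n => P)) := by
  rw [← ((measurePreserving_piFinSuccAbove (fun _ : Fin (n + 1) => P) 0).symm).integral_comp']
  simp [MeasurableEquiv.piFinSuccAbove, Fin.insertNthEquiv]

theorem measurable_fin_cons {Z : Type*} [MeasurableSpace Z] {n : ℕ} :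
    Measurable fun p : Z × (Fin n → Z) => (Fin.cons p.1 p.2 : Fin (n + 1) → Z) := by
  refine measurable_pi_lambda _ fun i => ?_
  refine Fin.cases ?_ (fun j => ?_) i
  · simpa using measurable_fst
  · simp only [Fin.cons_succ]
    fun_prop

theorem integrable_of_abs_le {α : Type*} [MeasurableSpace α] {μ : Measure α} [IsFiniteMeasure μ]
    {g : α → ℝ} (hg : Measurable g) {B : ℝ} (hB : ∀ a, |g a| ≤ B) : Integrable g μ :=
  Integrable.of_bound hg.aestronglyMeasurable B (Filter.Eventually.of_forall hB)

theorem abs_integral_le_of_abs_le {α : Type*} [MeasurableSpace α] {μ : Measure α}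
    [IsProbabilityMeasure μ] {g : α → ℝ} {B : ℝ} (hB : ∀ a, |g a| ≤ B) : |∫ a, g a ∂μ| ≤ B := by
  simpa using norm_integral_le_of_norm_le_const (μ := μ) (f := g) (C := B)
    (Filter.Eventually.of_forall hB)

/-- The moment generating function bound behind McDiarmid's bounded difference inequality. -/
theorem integral_exp_le_of_bounded_differences {Z : Type*} [MeasurableSpace Z] (P : Measure Z)
    [IsProbabilityMeasure P] {c B : ℝ} (s : ℝ) (n : ℕ) (W : (Fin n → Z) → ℝ)
    (hW : Measurable W) (hB : ∀ z, |W z| ≤ B)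
    (hc : ∀ z z' i, (∀ j, j ≠ i → z j = z' j) → W z - W z' ≤ c) :
    ∫ z, Real.exp (s * (W z - ∫ w, W w ∂(Measure.pi fun _ : Fin n => P)))
      ∂(Measure.pi fun _ : Fin n => P) ≤ Real.exp (n * c ^ 2 * s ^ 2 / 8) := by
  have hexp {α : Type _} [MeasurableSpace α] (μ : Measure α) [IsFiniteMeasure μ] (g : α → ℝ)
      (hg : Measurable g) {C : ℝ} (hC : ∀ a, |g a| ≤ C) :
      Integrable (fun a => Real.exp (s * g a)) μ := by
    refine integrable_of_abs_le (B := Real.exp (|s| * C)) (by fun_prop) fun a => ?_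
    rw [abs_of_pos (Real.exp_pos _), Real.exp_le_exp]
    calc s * g a ≤ |s * g a| := le_abs_self _
      _ = |s| * |g a| := abs_mul _ _
      _ ≤ |s| * C := by gcongr; exact hC a
  induction n with
  | zero =>
    have : ∀ z, W z = W default := fun z => congrArg W (Subsingleton.elim _ _)
    simp [this]
  | succ n ih =>
    set μ := Measure.pi fun _ : Fin n => P
    have hWc : Measurable fun p : Z × (Fin n → Z) => W (Fin.cons p.1 p.2) :=
      hW.comp measurable_fin_cons
    have hWx (x : Z) : Measurable fun y : Fin n → Z => W (Fin.cons x y) :=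
      hWc.comp measurable_prodMk_left
    set V : Z → ℝ := fun x => ∫ y, W (Fin.cons x y) ∂μ with hV
    have hVm : Measurable V :=
      (hWc.stronglyMeasurable.integral_prod_right' (ν := μ)).measurable
    have hVB (x : Z) : |V x| ≤ B :=
      abs_integral_le_of_abs_le fun y => hB (Fin.cons x y)
    have hmean : ∫ w, W w ∂(Measure.pi fun _ : Fin (n + 1) => P) = ∫ x, V x ∂P := by
      rw [integral_pi_fin_succ, integral_prod _ (integrable_of_abs_le hWc fun p => hB _)]
    rw [hmean]
    set m := ∫ x, V x ∂P with hm
    have hmB : |m| ≤ B := abs_integral_le_of_abs_le hVB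
    have hVc (x x' : Z) : V x - V x' ≤ c := by
      have h1 (x : Z) : Integrable (fun y => W (Fin.cons x y)) μ :=
        integrable_of_abs_le (hWx x) fun y => hB _
      rw [hV, ← integral_sub (h1 x) (h1 x')]
      calc _ ≤ ∫ _, c ∂μ := by
            refine integral_mono ((h1 x).sub (h1 x')) (integrable_const _) fun y => ?_
            refine hc _ _ 0 fun j hj => ?_
            obtain ⟨k, rfl⟩ := Fin.exists_succ_eq.2 hj
            simp
        _ = c := by simp
    have hfirst : ∫ x, Real.exp (s * (V x - m)) ∂P ≤ Real.exp (c ^ 2 * s ^ 2 / 8) := by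
      have hne : Nonempty Z := nonempty_of_isProbabilityMeasure P
      have hbdd : BddBelow (Set.range V) := ⟨-B, by rintro _ ⟨x, rfl⟩; exact (abs_le.1 (hVB x)).1⟩
      have hmem (x : Z) : V x ∈ Set.Icc (⨅ x, V x) ((⨅ x, V x) + c) := by
        refine ⟨ciInf_le hbdd x, ?_⟩
        have : V x - c ≤ ⨅ x, V x := le_ciInf fun x' => by linarith [hVc x x']
        linarith
      have h := (hasSubgaussianMGF_of_mem_Icc (μ := P) hVm.aemeasurable
        (Filter.Eventually.of_forall hmem)).mgf_le s
      refine h.trans (Real.exp_le_exp.2 (le_of_eq ?_))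
      simp only [add_sub_cancel_left, NNReal.coe_pow, NNReal.coe_div, coe_nnnorm,
        Real.norm_eq_abs, div_pow, sq_abs, NNReal.coe_ofNat]
      ring
    have hint : Integrable (fun p : Z × (Fin n → Z) =>
        Real.exp (s * (W (Fin.cons p.1 p.2) - m))) (P.prod μ) :=
      hexp _ _ (hWc.sub_const m) (C := B + B) fun p => (abs_sub _ _).trans (add_le_add (hB _) hmB)
    rw [integral_pi_fin_succ, integral_prod _ hint]
    calc ∫ x, ∫ y, Real.exp (s * (W (Fin.cons x y) - m)) ∂μ ∂P
        ≤ ∫ x, Real.exp (n * c ^ 2 * s ^ 2 / 8) * Real.exp (s * (V x - m)) ∂P := by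
          refine integral_mono hint.integral_prod_left ((hexp P _ (hVm.sub_const m)
            (C := B + B) fun x => (abs_sub _ _).trans
              (add_le_add (hVB x) hmB)).const_mul _) fun x => ?_
          have h1 : ∀ y, Real.exp (s * (W (Fin.cons x y) - m)) =
              Real.exp (s * (W (Fin.cons x y) - V x)) * Real.exp (s * (V x - m)) := fun y => by
            rw [← Real.exp_add]; ring_nf
          simp only [h1, integral_mul_const]
          gcongr
          refine ih _ (hWx x) (fun y => hB _) fun y y' i hy => hc _ _ i.succ fun j hj => ?_
          induction j using Fin.cases with
          | zero => simp
          | succ k => simpa using hy k (fun h => hj (congrArg Fin.succ h))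
      _ ≤ Real.exp (n * c ^ 2 * s ^ 2 / 8) * Real.exp (c ^ 2 * s ^ 2 / 8) := by
          rw [integral_const_mul]; gcongr
      _ = Real.exp ((n + 1 : ℕ) * c ^ 2 * s ^ 2 / 8) := by
          rw [← Real.exp_add]; push_cast; ring_nf

/-- A form of **McDiarmid's inequality**. -/
theorem measureReal_le_of_bounded_differences {Z : Type*} [MeasurableSpace Z] (P : Measure Z)
    [IsProbabilityMeasure P] {c B : ℝ} {n : ℕ} (W : (Fin n → Z) → ℝ)
    (hW : Measurable W) (hB : ∀ z, |W z| ≤ B)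
    (hc : ∀ z z' i, (∀ j, j ≠ i → z j = z' j) → W z - W z' ≤ c) {t : ℝ} (ht : 0 ≤ t) :
    (Measure.pi fun _ : Fin n => P).real
        {z | t ≤ W z - ∫ w, W w ∂(Measure.pi fun _ : Fin n => P)} ≤
      Real.exp (-(2 * t ^ 2) / (n * c ^ 2)) := by
  set μ := Measure.pi fun _ : Fin n => P
  have hmB : |∫ w, W w ∂μ| ≤ B := abs_integral_le_of_abs_le hB
  have h : HasSubgaussianMGF (fun z => W z - ∫ w, W w ∂μ) (Real.toNNReal (n * c ^ 2 / 4)) μ := by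
    refine ⟨fun s => ?_, fun s => ?_⟩
    · refine integrable_exp_mul_of_mem_Icc (a := -(B + B)) (b := B + B)
        (hW.sub_const _).aemeasurable (Filter.Eventually.of_forall fun z => ?_)
      exact abs_le.1 ((abs_sub _ _).trans (add_le_add (hB z) hmB))
    · refine (integral_exp_le_of_bounded_differences P s n W hW hB hc).trans
        (Real.exp_le_exp.2 (le_of_eq ?_))
      rw [Real.coe_toNNReal _ (by positivity)]; ring
  refine (h.measure_ge_le ht).trans (Real.exp_le_exp.2 (le_of_eq ?_))
  rw [Real.coe_toNNReal _ (by positivity)]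
  rcases eq_or_ne (n * c ^ 2) 0 with h0 | h0
  · simp [h0]
  · field_simp; norm_num

theorem abs_mean_le {n : ℕ} {a : Fin n → ℝ} {C : ℝ} (hC : 0 ≤ C) (ha : ∀ i, |a i| ≤ C) :
    |(n : ℝ)⁻¹ * ∑ i, a i| ≤ C := by
  rcases Nat.eq_zero_or_pos n with rfl | hn
  · simpa
  · have hn' : (0 : ℝ) < n := by exact_mod_cast hn
    rw [abs_mul, abs_of_pos (inv_pos.2 hn'), inv_mul_le_iff₀ hn']
    calc |∑ i, a i| ≤ ∑ i, |a i| := Finset.abs_sum_le_sum_abs _ _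
      _ ≤ ∑ _i : Fin n, C := Finset.sum_le_sum fun i _ => ha i
      _ = n * C := by simp

theorem bddAbove_range_of_abs_le {ι : Type*} {a : ι → ℝ} {C : ℝ} (ha : ∀ t, |a t| ≤ C) :
    BddAbove (Set.range a) :=
  ⟨C, by rintro _ ⟨t, rfl⟩; exact (abs_le.1 (ha t)).2⟩

theorem abs_ciSup_le {ι : Type*} [Nonempty ι] {a : ι → ℝ} {C : ℝ} (ha : ∀ t, |a t| ≤ C) :
    |⨆ t, a t| ≤ C :=
  abs_le.2 ⟨(abs_le.1 (ha (Classical.arbitrary ι))).1.trans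
    (le_ciSup (bddAbove_range_of_abs_le ha) _), ciSup_le fun t => (abs_le.1 (ha t)).2⟩

/-- The Rademacher sign attached to a Boolean. -/
def boolSign (b : Bool) : ℝ := if b then 1 else -1

@[simp] theorem boolSign_true : boolSign true = 1 := rfl

@[simp] theorem boolSign_false : boolSign false = -1 := rfl

@[simp] theorem boolSign_not (b : Bool) : boolSign (!b) = -boolSign b := by cases b <;> simp

@[simp] theorem abs_boolSign (b : Bool) : |boolSign b| = 1 := by cases b <;> simp

theorem sum_comp_not {n : ℕ} (g : (Fin n → Bool) → ℝ) :
    ∑ ε : Fin n → Bool, g (fun i => !ε i) = ∑ ε, g ε :=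
  (Equiv.piCongrRight fun _ : Fin n => Equiv.boolNot).sum_comp g

/-- The largest signed empirical mean over a family of functions. -/
noncomputable def signedSup {Z ι : Type*} {n : ℕ} (h : ι → Z → ℝ) (ε : Fin n → Bool)
    (z : Fin n → Z) : ℝ :=
  ⨆ t, (n : ℝ)⁻¹ * ∑ i, boolSign (ε i) * h t (z i)

theorem rad_eq_sum_signedSup {Z : Type*} {n : ℕ} (F : Set (Z → ℝ)) (z : Fin n → Z) :
    rad F z = (2 ^ n : ℝ)⁻¹ * ∑ ε : Fin n → Bool, signedSup (fun f : F => (f : Z → ℝ)) ε z :=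
  rfl

section Symmetrization

variable {Z ι : Type*} {n : ℕ} {h : ι → Z → ℝ} {B : ℝ}

theorem abs_signed_mean_le (hB0 : 0 ≤ B) (hB : ∀ t z, |h t z| ≤ B) (ε : Fin n → Bool)
    (z : Fin n → Z) (t : ι) : |(n : ℝ)⁻¹ * ∑ i, boolSign (ε i) * h t (z i)| ≤ B :=
  abs_mean_le hB0 fun i => by simpa [abs_mul] using hB t (z i)

theorem measurable_signedSup [MeasurableSpace Z] [Countable ι] (hm : ∀ t, Measurable (h t))
    (ε : Fin n → Bool) : Measurable (signedSup h ε) := by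
  unfold signedSup
  fun_prop

theorem integrable_signedSup [MeasurableSpace Z] [Countable ι] [Nonempty ι]
    (hm : ∀ t, Measurable (h t)) (hB0 : 0 ≤ B) (hB : ∀ t z, |h t z| ≤ B) (ε : Fin n → Bool)
    (μ : Measure (Fin n → Z)) [IsFiniteMeasure μ] : Integrable (signedSup h ε) μ :=
  integrable_of_abs_le (measurable_signedSup hm ε) fun z =>
    abs_ciSup_le (abs_signed_mean_le hB0 hB ε z)

theorem measurePreserving_swap_coordinates [MeasurableSpace Z] (P : Measure Z)
    [IsProbabilityMeasure P] (ε : Fin n → Bool) :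
    MeasurePreserving (fun p : (Fin n → Z) × (Fin n → Z) =>
        ((fun i => if ε i then p.1 i else p.2 i), fun i => if ε i then p.2 i else p.1 i))
      ((Measure.pi fun _ : Fin n => P).prod (Measure.pi fun _ : Fin n => P))
      ((Measure.pi fun _ : Fin n => P).prod (Measure.pi fun _ : Fin n => P)) := by
  have hA := measurePreserving_arrowProdEquivProdArrow Z Z (Fin n) (fun _ => P) (fun _ => P)
  have hT : MeasurePreserving (fun (q : Fin n → Z × Z) i => (if ε i then id else Prod.swap) (q i))
      (Measure.pi fun _ : Fin n => P.prod P) (Measure.pi fun _ : Fin n => P.prod P) := by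
    refine measurePreserving_pi _ _ fun i => ?_
    split_ifs
    · exact MeasurePreserving.id _
    · exact Measure.measurePreserving_swap
  have h := hA.comp (hT.comp hA.symm)
  convert h using 1
  funext p
  ext i <;> by_cases hi : ε i <;>
    simp [hi, MeasurableEquiv.arrowProdEquivProdArrow, Equiv.arrowProdEquivProdArrow]

theorem integral_iSup_mean_sub_le [MeasurableSpace Z] [Countable ι] [Nonempty ι]
    (P : Measure Z) [IsProbabilityMeasure P] (hn : 1 ≤ n)
    (hm : ∀ t, Measurable (h t)) (hB0 : 0 ≤ B) (hB : ∀ t z, |h t z| ≤ B) :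
    ∫ z, (⨆ t, ((n : ℝ)⁻¹ * ∑ i, h t (z i) - ∫ x, h t x ∂P)) ∂(Measure.pi fun _ : Fin n => P) ≤
      2 * ((2 ^ n : ℝ)⁻¹ * ∑ ε : Fin n → Bool,
        ∫ z, signedSup h ε z ∂(Measure.pi fun _ : Fin n => P)) := by
  set μ := Measure.pi fun _ : Fin n => P
  have hn0 : (n : ℝ) ≠ 0 := by positivity
  set D : (Fin n → Z) × (Fin n → Z) → ℝ := fun p =>
    ⨆ t, (n : ℝ)⁻¹ * ∑ i, (h t (p.1 i) - h t (p.2 i))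
  have hdiff (t : ι) (x y : Z) : |h t x - h t y| ≤ B + B :=
    (abs_sub _ _).trans (add_le_add (hB t x) (hB t y))
  have hterm (p : (Fin n → Z) × (Fin n → Z)) (t : ι) :
      |(n : ℝ)⁻¹ * ∑ i, (h t (p.1 i) - h t (p.2 i))| ≤ B + B :=
    abs_mean_le (by positivity) fun i => hdiff t _ _
  have hDm : Measurable D := by fun_prop
  have hDB (p) : |D p| ≤ B + B := abs_ciSup_le (hterm p)
  have hDi : Integrable D (μ.prod μ) := integrable_of_abs_le hDm hDB
  have hcoord (t : ι) (i : Fin n) : Integrable (fun z : Fin n → Z => h t (z i)) μ :=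
    integrable_of_abs_le (by fun_prop) fun z => hB t _
  have hmean (t : ι) (i : Fin n) : ∫ z, h t (z i) ∂μ = ∫ x, h t x ∂P :=
    integral_comp_eval (μ := fun _ : Fin n => P) (hm t).aestronglyMeasurable
  have hghost (z : Fin n → Z) (t : ι) :
      (n : ℝ)⁻¹ * ∑ i, h t (z i) - ∫ x, h t x ∂P ≤ ∫ z', D (z, z') ∂μ := by
    calc (n : ℝ)⁻¹ * ∑ i, h t (z i) - ∫ x, h t x ∂P
        = ∫ z', (n : ℝ)⁻¹ * ∑ i, (h t (z i) - h t (z' i)) ∂μ := by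
          rw [integral_const_mul, integral_finsetSum (f := fun i (z' : Fin n → Z) =>
            h t (z i) - h t (z' i)) _ fun i _ => (integrable_const _).sub (hcoord t i)]
          simp only [integral_sub (integrable_const _) (hcoord t _), hmean]
          simp [mul_sub, hn0]
      _ ≤ _ := integral_mono
          (integrable_of_abs_le (by fun_prop) fun z' => hterm (z, z') t)
          (integrable_of_abs_le (hDm.comp measurable_prodMk_left) fun z' => hDB (z, z'))
          fun z' => le_ciSup (bddAbove_range_of_abs_le (hterm (z, z'))) t
  have hleft : ∫ z, (⨆ t, ((n : ℝ)⁻¹ * ∑ i, h t (z i) - ∫ x, h t x ∂P)) ∂μ ≤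
      ∫ p, D p ∂(μ.prod μ) := by
    rw [integral_prod _ hDi]
    refine integral_mono (integrable_of_abs_le (by fun_prop) (B := B + B) fun z =>
      abs_ciSup_le fun t => ?_) hDi.integral_prod_left fun z => ciSup_le (hghost z)
    exact (abs_sub _ _).trans (add_le_add (abs_mean_le hB0 fun i => hB t _)
      (abs_integral_le_of_abs_le (hB t)))
  have hsign (ε : Fin n → Bool) : ∫ p, D p ∂(μ.prod μ) ≤
      ∫ z, signedSup h ε z ∂μ + ∫ z, signedSup h (fun i => !ε i) z ∂μ := by
    have hS := measurePreserving_swap_coordinates P ε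
    have h1 := integrable_signedSup hm hB0 hB ε μ
    have h2 := integrable_signedSup hm hB0 hB (fun i => !ε i) μ
    rw [← hS.map_eq, integral_map hS.measurable.aemeasurable hDm.aestronglyMeasurable]
    calc _ ≤ ∫ p : (Fin n → Z) × (Fin n → Z),
          (signedSup h ε p.1 + signedSup h (fun i => !ε i) p.2) ∂(μ.prod μ) := by
          refine integral_mono (integrable_of_abs_le (hDm.comp hS.measurable) fun p => hDB _)
            ((h1.comp_fst μ).add (h2.comp_snd μ)) fun p => ciSup_le fun t => ?_
          refine le_trans (le_of_eq ?_) (add_le_add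
            (le_ciSup (bddAbove_range_of_abs_le (abs_signed_mean_le hB0 hB ε p.1)) t)
            (le_ciSup (bddAbove_range_of_abs_le
              (abs_signed_mean_le hB0 hB (fun i => !ε i) p.2)) t))
          rw [← mul_add, ← Finset.sum_add_distrib]
          congr 1
          refine Finset.sum_congr rfl fun i _ => ?_
          cases hi : ε i <;> simp [hi] <;> ring
      _ = _ := by
          rw [integral_add (h1.comp_fst μ) (h2.comp_snd μ), integral_fun_fst, integral_fun_snd]
          simp
  have hsum := Finset.sum_le_sum fun ε (_ : ε ∈ (Finset.univ : Finset (Fin n → Bool))) => hsign ε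
  rw [Finset.sum_add_distrib, sum_comp_not fun ε => ∫ z, signedSup h ε z ∂μ] at hsum
  simp only [Finset.sum_const, Finset.card_univ, Fintype.card_fun, Fintype.card_bool,
    Fintype.card_fin, nsmul_eq_mul] at hsum
  push_cast at hsum
  refine hleft.trans ?_
  have h2 : (0 : ℝ) < 2 ^ n := by positivity
  rw [← mul_left_comm, le_inv_mul_iff₀ h2]
  linarith

end Symmetrization

/-- One step of the contraction principle: the nonlinearity is removed from a single coordinate. -/
theorem iSup_add_iSup_contraction {ι : Type*} [Nonempty ι] {ψ : ℝ → ℝ} {L : ℝ}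
    (hψ : ∀ x y, |ψ x - ψ y| ≤ L * |x - y|) {a x : ι → ℝ}
    (hp : BddAbove (Set.range fun t => a t + L * x t))
    (hq : BddAbove (Set.range fun t => a t - L * x t)) :
    (⨆ t, (a t + ψ (x t))) + (⨆ t, (a t - ψ (x t))) ≤
      (⨆ t, (a t + L * x t)) + ⨆ t, (a t - L * x t) := by
  have key (t u : ι) : (a t + ψ (x t)) + (a u - ψ (x u)) ≤
      (⨆ t, (a t + L * x t)) + ⨆ t, (a t - L * x t) := by
    have h := (le_abs_self _).trans (hψ (x t) (x u))
    rcases le_total (x u) (x t) with hle | hle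
    · rw [abs_of_nonneg (sub_nonneg.2 hle)] at h
      have h1 : a t + L * x t ≤ _ := le_ciSup hp t
      have h2 : a u - L * x u ≤ _ := le_ciSup hq u
      linarith
    · rw [abs_of_nonpos (sub_nonpos.2 hle)] at h
      have h1 : a u + L * x u ≤ _ := le_ciSup hp u
      have h2 : a t - L * x t ≤ _ := le_ciSup hq t
      linarith
  rw [← le_sub_iff_add_le]
  refine ciSup_le fun t => ?_
  rw [le_sub_comm]
  refine ciSup_le fun u => ?_
  linarith [key t u]

theorem sum_fin_succ_bool {n : ℕ} (g : (Fin (n + 1) → Bool) → ℝ) :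
    ∑ ε, g ε = ∑ ε : Fin n → Bool, (g (Fin.cons true ε) + g (Fin.cons false ε)) := by
  rw [← (Fin.consEquiv fun _ => Bool).sum_comp, Fintype.sum_prod_type, Fintype.sum_bool,
    ← Finset.sum_add_distrib]
  rfl

/-- The Ledoux–Talagrand **contraction principle** for Rademacher sums. -/
theorem sum_iSup_contraction {ι : Type*} [Nonempty ι] {ψ : ℝ → ℝ} {L C : ℝ} (hL : 0 ≤ L)
    (hψ : ∀ x y, |ψ x - ψ y| ≤ L * |x - y|) (n : ℕ) (a : ι → ℝ) (x : Fin n → ι → ℝ)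
    (ha : ∃ A, ∀ t, |a t| ≤ A) (hx : ∀ i t, |x i t| ≤ C) :
    ∑ ε : Fin n → Bool, ⨆ t, (a t + ∑ i, boolSign (ε i) * ψ (x i t)) ≤
      ∑ ε : Fin n → Bool, ⨆ t, (a t + L * ∑ i, boolSign (ε i) * x i t) := by
  induction n generalizing a with
  | zero => simp
  | succ n ih =>
    obtain ⟨A, hA⟩ := ha
    have hψb (t : ι) : |ψ (x 0 t)| ≤ L * C + |ψ 0| := by
      have h1 := hψ (x 0 t) 0
      have h2 : L * |x 0 t - 0| ≤ L * C := by
        rw [sub_zero]; exact mul_le_mul_of_nonneg_left (hx 0 t) hL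
      calc |ψ (x 0 t)| = |(ψ (x 0 t) - ψ 0) + ψ 0| := by ring_nf
        _ ≤ |ψ (x 0 t) - ψ 0| + |ψ 0| := abs_add_le _ _
        _ ≤ _ := by linarith
    have hpos := ih (fun t => a t + ψ (x 0 t)) (fun i => x i.succ)
      ⟨A + (L * C + |ψ 0|), fun t => (abs_add_le _ _).trans (add_le_add (hA t) (hψb t))⟩
      fun i => hx i.succ
    have hneg := ih (fun t => a t - ψ (x 0 t)) (fun i => x i.succ)
      ⟨A + (L * C + |ψ 0|), fun t => (abs_sub _ _).trans (add_le_add (hA t) (hψb t))⟩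
      fun i => hx i.succ
    rw [sum_fin_succ_bool, sum_fin_succ_bool]
    simp only [Fin.sum_univ_succ, Fin.cons_zero, Fin.cons_succ, boolSign_true, boolSign_false,
      one_mul, neg_mul]
    calc _ ≤ ∑ ε : Fin n → Bool,
          ((⨆ t, ((a t + L * ∑ i, boolSign (ε i) * x i.succ t) + ψ (x 0 t))) +
            ⨆ t, ((a t + L * ∑ i, boolSign (ε i) * x i.succ t) - ψ (x 0 t))) := by
          rw [Finset.sum_add_distrib, Finset.sum_add_distrib]
          refine add_le_add (le_of_eq_of_le ?_ (hpos.trans_eq ?_))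
            (le_of_eq_of_le ?_ (hneg.trans_eq ?_)) <;>
          · refine Finset.sum_congr rfl fun ε _ => iSup_congr fun t => ?_
            ring
      _ ≤ ∑ ε : Fin n → Bool,
          ((⨆ t, ((a t + L * ∑ i, boolSign (ε i) * x i.succ t) + L * x 0 t)) +
            ⨆ t, ((a t + L * ∑ i, boolSign (ε i) * x i.succ t) - L * x 0 t)) := by
          refine Finset.sum_le_sum fun ε _ => ?_
          have hsum (t : ι) : |∑ i, boolSign (ε i) * x i.succ t| ≤ n * C :=
            (Finset.abs_sum_le_sum_abs _ _).trans <|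
              (Finset.sum_le_sum fun i _ => by
                simpa [abs_mul] using hx i.succ t).trans_eq (by simp)
          have hlin (t : ι) : |a t + L * ∑ i, boolSign (ε i) * x i.succ t| ≤ A + L * (n * C) := by
            refine (abs_add_le _ _).trans (add_le_add (hA t) ?_)
            rw [abs_mul, abs_of_nonneg hL]
            exact mul_le_mul_of_nonneg_left (hsum t) hL
          have h0 (t : ι) : |L * x 0 t| ≤ L * C := by
            rw [abs_mul, abs_of_nonneg hL]
            exact mul_le_mul_of_nonneg_left (hx 0 t) hL
          exact iSup_add_iSup_contraction hψ
            (bddAbove_range_of_abs_le fun t => (abs_add_le _ _).trans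
              (add_le_add (hlin t) (h0 t)))
            (bddAbove_range_of_abs_le fun t => (abs_sub _ _).trans
              (add_le_add (hlin t) (h0 t)))
      _ = _ := by
          refine Finset.sum_congr rfl fun ε _ => ?_
          congr 1 <;> refine iSup_congr fun t => ?_ <;> ring

theorem sum_sq_add_sum_boolSign (n : ℕ) (a : ℝ) :
    ∑ ε : Fin n → Bool, (a + ∑ i, boolSign (ε i)) ^ 2 = 2 ^ n * (a ^ 2 + n) := by
  induction n generalizing a with
  | zero => simp
  | succ n ih =>
    rw [sum_fin_succ_bool]
    simp only [Fin.sum_univ_succ, Fin.cons_zero, Fin.cons_succ, boolSign_true, boolSign_false,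
      ← add_assoc, Finset.sum_add_distrib, ih]
    push_cast
    ring

/-- Khintchine's upper bound for the first moment of a simple random walk. -/
theorem sum_abs_sum_boolSign_le (n : ℕ) :
    ∑ ε : Fin n → Bool, |∑ i, boolSign (ε i)| ≤ 2 ^ n * Real.sqrt n := by
  refine (pow_le_pow_iff_left₀ (Finset.sum_nonneg fun _ _ => abs_nonneg _) (by positivity)
    two_ne_zero).1 ?_
  have h := sq_sum_le_card_mul_sum_sq (s := (Finset.univ : Finset (Fin n → Bool)))
    (f := fun ε => |∑ i, boolSign (ε i)|)
  have h2 := sum_sq_add_sum_boolSign n 0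
  simp only [sq_abs, Finset.card_univ, Fintype.card_fun, Fintype.card_bool,
    Fintype.card_fin] at h
  simp only [zero_add] at h2
  rw [h2] at h
  push_cast at h
  rw [mul_pow, Real.sq_sqrt (by positivity)]
  linarith

section UniformDeviation

variable {Z : Type*}

/-- The shifted and transformed functions `z ↦ ψ (q - f z)`, with `q` rational in `[0, M]`. -/
def shiftFamily (F : Set (Z → ℝ)) (M : ℝ) (ψ : ℝ → ℝ)
    (t : F × {q : ℚ // (q : ℝ) ∈ Set.Icc 0 M}) (z : Z) : ℝ :=
  ψ (t.2.1 - t.1.1 z)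

/-- The one-sided uniform deviation of empirical from population means over `shiftFamily`. -/
noncomputable def uniformDeviation [MeasurableSpace Z] (P : Measure Z) (F : Set (Z → ℝ)) (M : ℝ)
    (ψ : ℝ → ℝ) {n : ℕ} (z : Fin n → Z) : ℝ :=
  ⨆ t, ((n : ℝ)⁻¹ * ∑ i, shiftFamily F M ψ t (z i) - ∫ x, shiftFamily F M ψ t x ∂P)

variable {F : Set (Z → ℝ)} {M L : ℝ} {ψ : ℝ → ℝ} {n : ℕ}

theorem nonempty_shift_index (hM : 0 ≤ M) (hFne : F.Nonempty) :
    Nonempty (F × {q : ℚ // (q : ℝ) ∈ Set.Icc 0 M}) :=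
  ⟨⟨⟨_, hFne.some_mem⟩, ⟨0, by simpa using hM⟩⟩⟩

theorem abs_shift_le (hFbd : ∀ f ∈ F, ∀ z, f z ∈ Set.Icc 0 M)
    (t : F × {q : ℚ // (q : ℝ) ∈ Set.Icc 0 M}) (z : Z) : |(t.2.1 : ℝ) - t.1.1 z| ≤ M := by
  have h1 := hFbd _ t.1.2 z
  have h2 := t.2.2
  exact abs_le.2 ⟨by linarith [h1.2, h2.1], by linarith [h1.1, h2.2]⟩

theorem abs_shiftFamily_le (hL0 : 0 ≤ L) (hψ : ∀ x y, |ψ x - ψ y| ≤ L * |x - y|)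
    (hFbd : ∀ f ∈ F, ∀ z, f z ∈ Set.Icc 0 M)
    (t : F × {q : ℚ // (q : ℝ) ∈ Set.Icc 0 M}) (z : Z) :
    |shiftFamily F M ψ t z| ≤ L * M + |ψ 0| := by
  have h1 := hψ (t.2.1 - t.1.1 z) 0
  rw [sub_zero] at h1
  have h2 := mul_le_mul_of_nonneg_left (abs_shift_le hFbd t z) hL0
  have h3 := abs_sub_abs_le_abs_sub (ψ (t.2.1 - t.1.1 z)) (ψ 0)
  unfold shiftFamily
  linarith

theorem shiftFamily_sub_le (hL0 : 0 ≤ L) (hψ : ∀ x y, |ψ x - ψ y| ≤ L * |x - y|)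
    (hFbd : ∀ f ∈ F, ∀ z, f z ∈ Set.Icc 0 M)
    (t : F × {q : ℚ // (q : ℝ) ∈ Set.Icc 0 M}) (z z' : Z) :
    shiftFamily F M ψ t z - shiftFamily F M ψ t z' ≤ L * M := by
  refine (le_abs_self _).trans ((hψ _ _).trans (mul_le_mul_of_nonneg_left ?_ hL0))
  have h1 := hFbd _ t.1.2 z
  have h2 := hFbd _ t.1.2 z'
  exact abs_le.2 ⟨by linarith [h1.2, h2.1], by linarith [h1.1, h2.2]⟩

theorem measurable_shiftFamily [MeasurableSpace Z] (hFmeas : ∀ f ∈ F, Measurable f)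
    (hψm : Measurable ψ) (t : F × {q : ℚ // (q : ℝ) ∈ Set.Icc 0 M}) :
    Measurable (shiftFamily F M ψ t) :=
  hψm.comp ((hFmeas _ t.1.2).const_sub _)

theorem sum_signedSup_shiftFamily_le (hM : 0 ≤ M) (hn : 1 ≤ n) (hFne : F.Nonempty)
    (hFbd : ∀ f ∈ F, ∀ z, f z ∈ Set.Icc 0 M) (hL0 : 0 ≤ L)
    (hψ : ∀ x y, |ψ x - ψ y| ≤ L * |x - y|) (z : Fin n → Z) :
    (2 ^ n : ℝ)⁻¹ * ∑ ε : Fin n → Bool, signedSup (shiftFamily F M ψ) ε z ≤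
      L * (rad F z + M / Real.sqrt n) := by
  have := nonempty_shift_index hM hFne
  have hn0 : (0 : ℝ) < n := by exact_mod_cast hn
  have hFabs (f : F) (z : Z) : |(f : Z → ℝ) z| ≤ M :=
    (abs_of_nonneg (hFbd f f.2 z).1).trans_le (hFbd f f.2 z).2
  have hcontr := sum_iSup_contraction (ψ := fun x => (n : ℝ)⁻¹ * ψ x) (L := (n : ℝ)⁻¹ * L) (C := M)
    (by positivity) (fun x y => by
      rw [← mul_sub, abs_mul, abs_of_pos (inv_pos.2 hn0), mul_assoc]
      exact mul_le_mul_of_nonneg_left (hψ x y) (by positivity)) n (fun _ => 0)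
    (fun i (t : F × {q : ℚ // (q : ℝ) ∈ Set.Icc 0 M}) => (t.2.1 : ℝ) - t.1.1 (z i))
    ⟨0, by simp⟩ fun i t => abs_shift_le hFbd t (z i)
  have hle (ε : Fin n → Bool) :
      (⨆ t : F × {q : ℚ // (q : ℝ) ∈ Set.Icc 0 M},
        ((0 : ℝ) + (n : ℝ)⁻¹ * L * ∑ i, boolSign (ε i) * ((t.2.1 : ℝ) - t.1.1 (z i)))) ≤
      L * (signedSup (fun f : F => (f : Z → ℝ)) (fun i => !ε i) z +
        (n : ℝ)⁻¹ * M * |∑ i, boolSign (ε i)|) := by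
    refine ciSup_le fun t => ?_
    have h1 : (n : ℝ)⁻¹ * ∑ i, boolSign (!ε i) * t.1.1 (z i) ≤
        signedSup (fun f : F => (f : Z → ℝ)) (fun i => !ε i) z :=
      le_ciSup (bddAbove_range_of_abs_le
        (abs_signed_mean_le hM hFabs (fun i => !ε i) z)) t.1
    have h2 : (t.2.1 : ℝ) * ∑ i, boolSign (ε i) ≤ M * |∑ i, boolSign (ε i)| :=
      (mul_le_mul_of_nonneg_left (le_abs_self _) t.2.2.1).trans
        (mul_le_mul_of_nonneg_right t.2.2.2 (abs_nonneg _))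
    have h3 : ∑ i, boolSign (ε i) * ((t.2.1 : ℝ) - t.1.1 (z i)) =
        ∑ i, boolSign (!ε i) * t.1.1 (z i) + (t.2.1 : ℝ) * ∑ i, boolSign (ε i) := by
      rw [Finset.mul_sum, ← Finset.sum_add_distrib]
      refine Finset.sum_congr rfl fun i _ => ?_
      rw [boolSign_not]; ring
    calc _ = L * ((n : ℝ)⁻¹ * ∑ i, boolSign (!ε i) * t.1.1 (z i) +
          (n : ℝ)⁻¹ * ((t.2.1 : ℝ) * ∑ i, boolSign (ε i))) := by rw [h3]; ring
      _ ≤ _ := by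
          rw [mul_assoc]
          gcongr
  have hsqrt : (n : ℝ)⁻¹ * (M * (2 ^ n * Real.sqrt n)) = 2 ^ n * (M / Real.sqrt n) := by
    field_simp
    rw [Real.sq_sqrt hn0.le, mul_comm]
  rw [inv_mul_le_iff₀ (by positivity)]
  calc ∑ ε : Fin n → Bool, signedSup (shiftFamily F M ψ) ε z
      = ∑ ε : Fin n → Bool, ⨆ t : F × {q : ℚ // (q : ℝ) ∈ Set.Icc 0 M},
          ((0 : ℝ) + ∑ i, boolSign (ε i) * ((n : ℝ)⁻¹ * ψ ((t.2.1 : ℝ) - t.1.1 (z i)))) := by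
        refine Finset.sum_congr rfl fun ε _ => iSup_congr fun t => ?_
        rw [zero_add, Finset.mul_sum]
        exact Finset.sum_congr rfl fun i _ => mul_left_comm _ _ _
    _ ≤ _ := hcontr.trans (Finset.sum_le_sum fun ε _ => hle ε)
    _ = L * (∑ ε : Fin n → Bool, signedSup (fun f : F => (f : Z → ℝ)) ε z +
          (n : ℝ)⁻¹ * (M * ∑ ε : Fin n → Bool, |∑ i, boolSign (ε i)|)) := by
        rw [← Finset.mul_sum, Finset.sum_add_distrib, ← Finset.mul_sum, mul_assoc,
          sum_comp_not fun ε => signedSup (fun f : F => (f : Z → ℝ)) ε z]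
    _ ≤ L * (∑ ε : Fin n → Bool, signedSup (fun f : F => (f : Z → ℝ)) ε z +
          (n : ℝ)⁻¹ * (M * (2 ^ n * Real.sqrt n))) := by
        gcongr
        exact sum_abs_sum_boolSign_le n
    _ = 2 ^ n * (L * (rad F z + M / Real.sqrt n)) := by
        rw [hsqrt, rad_eq_sum_signedSup]
        field_simp

variable [MeasurableSpace Z]

theorem measurable_uniformDeviation (P : Measure Z) (hFc : F.Countable)
    (hFmeas : ∀ f ∈ F, Measurable f) (hψm : Measurable ψ) :
    Measurable (uniformDeviation P F M ψ (n := n)) := by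
  have := hFc.to_subtype
  have hm := measurable_shiftFamily (M := M) hFmeas hψm
  unfold uniformDeviation
  fun_prop

theorem abs_mean_shiftFamily_sub_le (P : Measure Z) [IsProbabilityMeasure P] (hM : 0 ≤ M)
    (hFbd : ∀ f ∈ F, ∀ z, f z ∈ Set.Icc 0 M) (hL0 : 0 ≤ L)
    (hψ : ∀ x y, |ψ x - ψ y| ≤ L * |x - y|) (z : Fin n → Z)
    (t : F × {q : ℚ // (q : ℝ) ∈ Set.Icc 0 M}) :
    |(n : ℝ)⁻¹ * ∑ i, shiftFamily F M ψ t (z i) - ∫ x, shiftFamily F M ψ t x ∂P| ≤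
      (L * M + |ψ 0|) + (L * M + |ψ 0|) :=
  (abs_sub _ _).trans (add_le_add
    (abs_mean_le (by positivity) fun i => abs_shiftFamily_le hL0 hψ hFbd t _)
    (abs_integral_le_of_abs_le (abs_shiftFamily_le hL0 hψ hFbd t)))

theorem abs_uniformDeviation_le (P : Measure Z) [IsProbabilityMeasure P] (hM : 0 ≤ M)
    (hFne : F.Nonempty) (hFbd : ∀ f ∈ F, ∀ z, f z ∈ Set.Icc 0 M) (hL0 : 0 ≤ L)
    (hψ : ∀ x y, |ψ x - ψ y| ≤ L * |x - y|) (z : Fin n → Z) :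
    |uniformDeviation P F M ψ z| ≤ (L * M + |ψ 0|) + (L * M + |ψ 0|) :=
  have := nonempty_shift_index hM hFne
  abs_ciSup_le (abs_mean_shiftFamily_sub_le P hM hFbd hL0 hψ z)

theorem mean_sub_integral_le_uniformDeviation (P : Measure Z) [IsProbabilityMeasure P]
    (hM : 0 ≤ M) (hFbd : ∀ f ∈ F, ∀ z, f z ∈ Set.Icc 0 M) (hL0 : 0 ≤ L)
    (hψ : ∀ x y, |ψ x - ψ y| ≤ L * |x - y|) (z : Fin n → Z)
    (t : F × {q : ℚ // (q : ℝ) ∈ Set.Icc 0 M}) :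
    (n : ℝ)⁻¹ * ∑ i, shiftFamily F M ψ t (z i) - ∫ x, shiftFamily F M ψ t x ∂P ≤
      uniformDeviation P F M ψ z :=
  le_ciSup (bddAbove_range_of_abs_le (abs_mean_shiftFamily_sub_le P hM hFbd hL0 hψ z)) t

theorem uniformDeviation_sub_le (P : Measure Z) [IsProbabilityMeasure P] (hM : 0 ≤ M)
    (hFne : F.Nonempty) (hFbd : ∀ f ∈ F, ∀ z, f z ∈ Set.Icc 0 M) (hL0 : 0 ≤ L)
    (hψ : ∀ x y, |ψ x - ψ y| ≤ L * |x - y|) (z z' : Fin n → Z) (i : Fin n)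
    (hz : ∀ j, j ≠ i → z j = z' j) :
    uniformDeviation P F M ψ z - uniformDeviation P F M ψ z' ≤ (n : ℝ)⁻¹ * (L * M) := by
  have := nonempty_shift_index hM hFne
  rw [sub_le_iff_le_add]
  refine ciSup_le fun t => ?_
  have h1 := mean_sub_integral_le_uniformDeviation P hM hFbd hL0 hψ z' t
  have h2 : ∑ j, shiftFamily F M ψ t (z j) - ∑ j, shiftFamily F M ψ t (z' j) ≤ L * M := by
    rw [← Finset.sum_sub_distrib, Finset.sum_eq_single i (fun j _ hj => by rw [hz j hj, sub_self])
      (by simp)]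
    exact shiftFamily_sub_le hL0 hψ hFbd t _ _
  have h3 := mul_le_mul_of_nonneg_left h2 (inv_nonneg.2 (Nat.cast_nonneg (α := ℝ) n))
  rw [mul_sub] at h3
  linarith

theorem integral_uniformDeviation_le (P : Measure Z) [IsProbabilityMeasure P] (hM : 0 ≤ M)
    (hn : 1 ≤ n) (hFc : F.Countable) (hFne : F.Nonempty) (hFmeas : ∀ f ∈ F, Measurable f)
    (hFbd : ∀ f ∈ F, ∀ z, f z ∈ Set.Icc 0 M) (hL0 : 0 ≤ L) (hψm : Measurable ψ)
    (hψ : ∀ x y, |ψ x - ψ y| ≤ L * |x - y|) :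
    ∫ z, uniformDeviation P F M ψ z ∂(Measure.pi fun _ : Fin n => P) ≤
      2 * (L * (∫ w, rad F w ∂(Measure.pi fun _ : Fin n => P) + M / Real.sqrt n)) := by
  have := nonempty_shift_index hM hFne
  have := hFc.to_subtype
  have := hFne.to_subtype
  have hB0 : 0 ≤ L * M + |ψ 0| := by positivity
  have hm := measurable_shiftFamily (M := M) hFmeas hψm
  have hB := abs_shiftFamily_le hL0 hψ hFbd
  have hint (ε : Fin n → Bool) := integrable_signedSup hm hB0 hB ε (Measure.pi fun _ => P)
  have hrad : Integrable (fun w => rad F w) (Measure.pi fun _ : Fin n => P) := by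
    simp only [rad_eq_sum_signedSup]
    exact (integrable_finsetSum _ fun ε _ => integrable_signedSup (fun f : F => hFmeas f f.2) hM
      (fun f z => (abs_of_nonneg (hFbd f f.2 z).1).trans_le (hFbd f f.2 z).2) ε _).const_mul _
  refine (integral_iSup_mean_sub_le P hn hm hB0 hB).trans ?_
  rw [← integral_finsetSum _ fun ε _ => hint ε, ← integral_const_mul]
  gcongr
  calc _ ≤ ∫ w, L * (rad F w + M / Real.sqrt n) ∂(Measure.pi fun _ : Fin n => P) :=
        integral_mono ((integrable_finsetSum _ fun ε _ => hint ε).const_mul _)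
          ((hrad.add (integrable_const _)).const_mul _)
          (sum_signedSup_shiftFamily_le hM hn hFne hFbd hL0 hψ)
    _ = _ := by
        rw [integral_const_mul, integral_add hrad (integrable_const _)]
        simp

end UniformDeviation

namespace IsDisutility

variable {φ : ℝ → ℝ}

theorem mul_le (hφ : IsDisutility φ) {s : ℝ} (hs : s ∈ Set.Icc (0 : ℝ) 1) (v : ℝ) :
    φ (s * v) ≤ s * φ v := by
  have h := hφ.2.1.2 (Set.mem_univ v) (Set.mem_univ 0) hs.1 (sub_nonneg.2 hs.2)
    (add_sub_cancel _ _)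
  simpa [hφ.2.2.1] using h

theorem sub_le_sub_of_nonneg (hφ : IsDisutility φ) {u v : ℝ} (hu : 0 ≤ u) (huv : u ≤ v) :
    φ u - u ≤ φ v - v := by
  rcases huv.eq_or_lt with rfl | hlt
  · exact le_rfl
  have hv : 0 < v := hu.trans_lt hlt
  have h := hφ.mul_le (s := u / v) ⟨by positivity, (div_le_one hv).2 huv⟩ v
  rw [div_mul_cancel₀ _ hv.ne'] at h
  have h1 : u / v * (φ v - v) ≤ 1 * (φ v - v) :=
    mul_le_mul_of_nonneg_right ((div_le_one hv).2 huv) (sub_nonneg.2 (hφ.2.2.2 v))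
  have h2 : u / v * v = u := div_mul_cancel₀ _ hv.ne'
  linarith [mul_sub (u / v) (φ v) v]

theorem sub_le_sub_of_nonpos (hφ : IsDisutility φ) {u v : ℝ} (hu : u ≤ 0) (huv : v ≤ u) :
    φ u - u ≤ φ v - v := by
  rcases huv.eq_or_lt with rfl | hlt
  · exact le_rfl
  have hv : v < 0 := hlt.trans_le hu
  have h01 : u / v ≤ 1 := (div_le_one_of_neg hv).2 huv
  have h := hφ.mul_le (s := u / v) ⟨div_nonneg_of_nonpos hu hv.le, h01⟩ v
  rw [div_mul_cancel₀ _ hv.ne] at h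
  have h1 : u / v * (φ v - v) ≤ 1 * (φ v - v) :=
    mul_le_mul_of_nonneg_right h01 (sub_nonneg.2 (hφ.2.2.2 v))
  have h2 : u / v * v = u := div_mul_cancel₀ _ hv.ne
  linarith [mul_sub (u / v) (φ v) v]

/-- Clamping the shift to the range of the loss improves the inverted OCE integrand. -/
theorem sub_le_clamp (hφ : IsDisutility φ) {M x : ℝ} (hx : x ∈ Set.Icc 0 M) (lam : ℝ) :
    lam - φ (lam - x) ≤ max 0 (min lam M) - φ (max 0 (min lam M) - x) := by
  have hM := hx.1.trans hx.2
  rcases le_total lam 0 with h0 | h0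
  · rw [min_eq_left (h0.trans hM), max_eq_left h0]
    linarith [hφ.sub_le_sub_of_nonpos (u := 0 - x) (v := lam - x) (by linarith [hx.1])
      (by linarith)]
  rcases le_total lam M with h1 | h1
  · rw [min_eq_left h1, max_eq_right h0]
  · rw [min_eq_right h1, max_eq_right hM]
    linarith [hφ.sub_le_sub_of_nonneg (u := M - x) (v := lam - x) (by linarith [hx.2])
      (by linarith)]

end IsDisutility

section IOCE

variable {Z : Type*} [MeasurableSpace Z] {φ : ℝ → ℝ} {f : Z → ℝ} {M : ℝ}

theorem integrable_comp_const_sub (hφ : IsDisutility φ) (hf : Measurable f)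
    (hfb : ∀ z, f z ∈ Set.Icc 0 M) (Q : Measure Z) [IsProbabilityMeasure Q] (lam : ℝ) :
    Integrable (fun z => φ (lam - f z)) Q :=
  Integrable.of_mem_Icc (φ (lam - M)) (φ lam)
    (hφ.1.measurable.comp (hf.const_sub lam)).aemeasurable
    (Filter.Eventually.of_forall fun z =>
      ⟨hφ.1 (by linarith [(hfb z).2]), hφ.1 (by linarith [(hfb z).1])⟩)

theorem bddAbove_ioce (hφ : IsDisutility φ) (hf : Measurable f)
    (hfb : ∀ z, f z ∈ Set.Icc 0 M) (Q : Measure Z) [IsProbabilityMeasure Q] :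
    BddAbove (Set.range fun lam : ℝ => lam - ∫ z, φ (lam - f z) ∂Q) := by
  refine ⟨M, ?_⟩
  rintro _ ⟨lam, rfl⟩
  have h : ∫ _ : Z, (lam - M) ∂Q ≤ ∫ z, φ (lam - f z) ∂Q :=
    integral_mono (integrable_const _) (integrable_comp_const_sub hφ hf hfb Q lam) fun z =>
      le_trans (by linarith [(hfb z).2]) (hφ.2.2.2 _)
  simp only [integral_const, probReal_univ, one_smul] at h
  simp only
  linarith

theorem ioce_le_ioce_add (hφ : IsDisutility φ) (hM : 0 ≤ M) (hf : Measurable f)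
    (hfb : ∀ z, f z ∈ Set.Icc 0 M) (Q Q' : Measure Z) [IsProbabilityMeasure Q]
    [IsProbabilityMeasure Q'] {d : ℝ}
    (hd : ∀ q : ℚ, (q : ℝ) ∈ Set.Icc 0 M →
      ∫ z, φ (q - f z) ∂Q' - ∫ z, φ (q - f z) ∂Q ≤ d) :
    IOCE φ f Q ≤ IOCE φ f Q' + d := by
  have hint := integrable_comp_const_sub hφ hf hfb Q
  refine ciSup_le fun lam => ?_
  set lam' := max 0 (min lam M)
  have hlam0 : 0 ≤ lam' := le_max_left _ _
  have hlamM : lam' ≤ M := max_le hM (min_le_right _ _)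
  have hclamp : lam - ∫ z, φ (lam - f z) ∂Q ≤ lam' - ∫ z, φ (lam' - f z) ∂Q := by
    have h := integral_mono ((integrable_const lam).sub (hint lam))
      ((integrable_const lam').sub (hint lam')) fun z => hφ.sub_le_clamp (hfb z) lam
    simpa [integral_sub, hint] using h
  refine le_of_forall_pos_le_add fun η hη => ?_
  obtain ⟨q, hq, hq1, hq2⟩ : ∃ q : ℚ, (q : ℝ) ∈ Set.Icc 0 M ∧ (q : ℝ) ≤ lam' ∧
      lam' - η ≤ q := by
    rcases hlam0.eq_or_lt with h0 | h0
    · exact ⟨0, by simpa using hM, by simpa using hlam0, by simp; linarith⟩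
    · obtain ⟨q, h1, h2⟩ := exists_rat_btwn (max_lt h0 (sub_lt_self lam' hη))
      exact ⟨q, ⟨(le_max_left _ _).trans h1.le, h2.le.trans hlamM⟩, h2.le,
        (le_max_right _ _).trans h1.le⟩
  have hmono : ∫ z, φ (q - f z) ∂Q ≤ ∫ z, φ (lam' - f z) ∂Q :=
    integral_mono (hint q) (hint lam') fun z => hφ.1 (by linarith)
  have hsup : (q : ℝ) - ∫ z, φ (q - f z) ∂Q' ≤ IOCE φ f Q' :=
    le_ciSup (bddAbove_ioce hφ hf hfb Q') (q : ℝ)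
  linarith [hd q hq]

theorem isProbabilityMeasure_empMeas {n : ℕ} (hn : 1 ≤ n) (z : Fin n → Z) :
    IsProbabilityMeasure (empMeas z) := by
  refine ⟨?_⟩
  simp only [empMeas, Measure.smul_apply, Measure.finsetSum_apply, measure_univ,
    Finset.sum_const, Finset.card_univ, Fintype.card_fin, nsmul_eq_mul, mul_one, smul_eq_mul]
  exact ENNReal.inv_mul_cancel (by exact_mod_cast (by omega : n ≠ 0)) (ENNReal.natCast_ne_top n)

theorem integral_empMeas {n : ℕ} (z : Fin n → Z) {g : Z → ℝ} (hg : Measurable g) :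
    ∫ x, g x ∂(empMeas z) = (n : ℝ)⁻¹ * ∑ i, g (z i) := by
  rw [empMeas, integral_smul_measure, integral_finsetSum_measure fun i _ =>
    integrable_dirac' hg.stronglyMeasurable (by simp)]
  simp [integral_dirac' _ _ hg.stronglyMeasurable]

end IOCE

theorem ioce_le_ioce_add_excess {Z : Type*} [MeasurableSpace Z] {P : Measure Z}
    [IsProbabilityMeasure P] {M : ℝ} (hM : 0 ≤ M) {F : Set (Z → ℝ)}
    (hFmeas : ∀ f ∈ F, Measurable f) (hFbd : ∀ f ∈ F, ∀ z, f z ∈ Set.Icc 0 M)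
    {φ : ℝ → ℝ} (hφ : IsDisutility φ) {L : ℝ} (hL0 : 0 ≤ L)
    (hL : ∀ x y : ℝ, |φ x - φ y| ≤ L * |x - y|) {n : ℕ} (hn : 1 ≤ n) (z : Fin n → Z)
    {f g : Z → ℝ} (hf : f ∈ F) (hg : g ∈ F)
    (hfg : IOCE φ f (empMeas z) ≤ IOCE φ g (empMeas z)) :
    IOCE φ f P ≤ IOCE φ g P +
      (uniformDeviation P F M φ z + uniformDeviation P F M (fun x => -φ x) z) := by
  have := isProbabilityMeasure_empMeas hn z
  have hneg : ∀ x y : ℝ, |-φ x - -φ y| ≤ L * |x - y| := fun x y => by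
    rw [neg_sub_neg, abs_sub_comm]; exact hL x y
  have hemp {f : Z → ℝ} (hf : f ∈ F) (q : ℝ) :
      ∫ x, φ (q - f x) ∂(empMeas z) = (n : ℝ)⁻¹ * ∑ i, φ (q - f (z i)) :=
    integral_empMeas z (hφ.1.measurable.comp ((hFmeas f hf).const_sub q))
  have h1 : IOCE φ f P ≤ IOCE φ f (empMeas z) + uniformDeviation P F M φ z := by
    refine ioce_le_ioce_add hφ hM (hFmeas f hf) (hFbd f hf) _ _ fun q hq => ?_
    rw [hemp hf]
    exact mean_sub_integral_le_uniformDeviation P hM hFbd hL0 hL z (⟨f, hf⟩, ⟨q, hq⟩)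
  have h2 : IOCE φ g (empMeas z) ≤ IOCE φ g P + uniformDeviation P F M (fun x => -φ x) z := by
    refine ioce_le_ioce_add hφ hM (hFmeas g hg) (hFbd g hg) _ _ fun q hq => ?_
    have h := mean_sub_integral_le_uniformDeviation P hM hFbd hL0 hneg z (⟨g, hg⟩, ⟨q, hq⟩)
    simp only [shiftFamily, integral_neg, Finset.sum_neg_distrib] at h
    rw [hemp hg]
    linarith
  linarith

/-- inverted-OCE guarantee for the empirical inverted-OCE minimizer.  With
probability at least `1 − δ` over the sample, every minimizer of the empirical inverted OCE
over `F` has population inverted OCE within `L·(4·E[Rad] + 2M(2 + √log(2/δ))/√n)` of the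
best-in-class population inverted OCE. -/
theorem ioce_guarantee {Z : Type*} [MeasurableSpace Z]
    (P : Measure Z) [IsProbabilityMeasure P] (M : ℝ) (hM : 0 < M)
    (F : Set (Z → ℝ)) (hFc : F.Countable) (hFne : F.Nonempty)
    (hFmeas : ∀ f ∈ F, Measurable f) (hFbd : ∀ f ∈ F, ∀ z, f z ∈ Set.Icc 0 M)
    (φ : ℝ → ℝ) (hφ : IsDisutility φ)
    (L : ℝ) (hL : ∀ x y : ℝ, |φ x - φ y| ≤ L * |x - y|)
    (n : ℕ) (hn : 1 ≤ n) (δ : ℝ) (hδ : δ ∈ Set.Ioc (0 : ℝ) 1) :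
    ENNReal.ofReal (1 - δ) ≤
      (Measure.pi fun _ : Fin n => P)
        {z : Fin n → Z |
          ∀ fhat ∈ F, (∀ g ∈ F, IOCE φ fhat (empMeas z) ≤ IOCE φ g (empMeas z)) →
            IOCE φ fhat P ≤ (⨅ g : F, IOCE φ (g : Z → ℝ) P) +
              L * (4 * (∫ w, rad F w ∂(Measure.pi fun _ : Fin n => P)) +
                2 * M * (2 + Real.sqrt (Real.log (2 / δ))) / Real.sqrt n)} := by
  have hL1 : 0 < L := by
    have h1 := (le_abs_self _).trans (hL 1 0)
    have h2 := hφ.2.2.2 1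
    rw [hφ.2.2.1] at h1
    norm_num at h1
    linarith
  have hL0 : 0 ≤ L := hL1.le
  have hneg : ∀ x y : ℝ, |-φ x - -φ y| ≤ L * |x - y| := fun x y => by
    rw [neg_sub_neg, abs_sub_comm]; exact hL x y
  have hn0 : (0 : ℝ) < n := by exact_mod_cast hn
  set μ := Measure.pi fun _ : Fin n => P
  set W : (Fin n → Z) → ℝ := fun z =>
    uniformDeviation P F M φ z + uniformDeviation P F M (fun x => -φ x) z with hW
  have hm1 : Measurable (uniformDeviation P F M φ (n := n)) :=
    measurable_uniformDeviation P hFc hFmeas hφ.1.measurable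
  have hm2 : Measurable (uniformDeviation P F M (fun x => -φ x) (n := n)) :=
    measurable_uniformDeviation P hFc hFmeas hφ.1.measurable.neg
  have hWm : Measurable W := hm1.add hm2
  have hb1 (z : Fin n → Z) := abs_uniformDeviation_le P hM.le hFne hFbd hL0 hL z
  have hb2 (z : Fin n → Z) := abs_uniformDeviation_le P hM.le hFne hFbd hL0 hneg z
  have hmean : ∫ z, W z ∂μ ≤ L * (4 * (∫ w, rad F w ∂μ) + 4 * M / Real.sqrt n) := by
    rw [hW, integral_add (integrable_of_abs_le hm1 hb1) (integrable_of_abs_le hm2 hb2)]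
    have h1 := integral_uniformDeviation_le P hM.le hn hFc hFne hFmeas hFbd hL0 hφ.1.measurable hL
    have h2 := integral_uniformDeviation_le P hM.le hn hFc hFne hFmeas hFbd hL0
      hφ.1.measurable.neg hneg
    refine (add_le_add h1 h2).trans_eq ?_
    ring
  set ℓ := Real.log (2 / δ)
  have hδ0 : 0 < δ := hδ.1
  have hℓ : 0 ≤ ℓ := Real.log_nonneg (by rw [le_div_iff₀ hδ0]; linarith [hδ.2])
  set t := L * (2 * M * Real.sqrt ℓ / Real.sqrt n) with ht
  have htail : μ.real {z | t ≤ W z - ∫ w, W w ∂μ} ≤ δ := by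
    refine (measureReal_le_of_bounded_differences P (c := 2 * ((n : ℝ)⁻¹ * (L * M))) W hWm
      (fun z => (abs_add_le _ _).trans (add_le_add (hb1 z) (hb2 z))) (fun z z' i hz => ?_)
      (by positivity)).trans ?_
    · have h1 := uniformDeviation_sub_le P hM.le hFne hFbd hL0 hL z z' i hz
      have h2 := uniformDeviation_sub_le P hM.le hFne hFbd hL0 hneg z z' i hz
      simp only [hW]
      linarith
    · have hexp : -(2 * t ^ 2) / (n * (2 * ((n : ℝ)⁻¹ * (L * M))) ^ 2) = -(2 * ℓ) := by
        rw [ht, mul_pow, div_pow, mul_pow, Real.sq_sqrt hℓ, Real.sq_sqrt hn0.le]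
        field_simp
      calc _ ≤ Real.exp (-ℓ) := by rw [hexp, Real.exp_le_exp]; linarith
        _ = δ / 2 := by rw [Real.exp_neg, Real.exp_log (by positivity), inv_div]
        _ ≤ δ := by linarith
  have hgood : {z | t ≤ W z - ∫ w, W w ∂μ}ᶜ ⊆ {z : Fin n → Z |
          ∀ fhat ∈ F, (∀ g ∈ F, IOCE φ fhat (empMeas z) ≤ IOCE φ g (empMeas z)) →
            IOCE φ fhat P ≤ (⨅ g : F, IOCE φ (g : Z → ℝ) P) +
              L * (4 * (∫ w, rad F w ∂μ) +
                2 * M * (2 + Real.sqrt ℓ) / Real.sqrt n)} := by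
    intro z hz fhat hfhat hmin
    have hWz : W z < ∫ w, W w ∂μ + t := by
      rw [Set.mem_compl_iff, Set.mem_ofPred_eq, not_le] at hz
      linarith
    have hbound : W z ≤ L * (4 * (∫ w, rad F w ∂μ) +
        2 * M * (2 + Real.sqrt ℓ) / Real.sqrt n) :=
      (hWz.le.trans (add_le_add_left hmean t)).trans_eq (by rw [ht]; ring)
    have := hFne.to_subtype
    rw [← sub_le_iff_le_add]
    refine le_ciInf fun g => ?_
    have := ioce_le_ioce_add_excess (P := P) hM.le hFmeas hFbd hφ hL0 hL hn z hfhat g.2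
      (hmin g g.2)
    linarith
  have hset : MeasurableSet {z | t ≤ W z - ∫ w, W w ∂μ} :=
    measurableSet_le measurable_const (hWm.sub_const _)
  calc ENNReal.ofReal (1 - δ) ≤ ENNReal.ofReal (μ.real {z | t ≤ W z - ∫ w, W w ∂μ}ᶜ) := by
        rw [probReal_compl_eq_one_sub hset]
        exact ENNReal.ofReal_le_ofReal (by linarith)
    _ = μ {z | t ≤ W z - ∫ w, W w ∂μ}ᶜ := ofReal_measureReal
    _ ≤ _ := measure_mono hgood
end

section
/- Let (Z, 𝒜, P) be a probability space, M > 0, f : Z → [0, M] measurable, and let φ : ℝ → ℝ be a disutility function that is Lipschitz with constant L. Write R(f) = ∫ f dP. Then 0 ≤ IOCE_φ(f;P) ≤ R(f) ≤ OCE_φ(f;P) ≤ L·R(f). -/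
open MeasureTheory Finset Set ENNReal

/-- mean-based characterization of OCE risks:
`0 ≤ IOCE_φ(f;P) ≤ R(f) ≤ OCE_φ(f;P) ≤ L·R(f)`. -/
theorem oce_mean_characterization {Z : Type*} [MeasurableSpace Z]
    (P : Measure Z) [IsProbabilityMeasure P] (M : ℝ) (hM : 0 < M)
    (f : Z → ℝ) (hf : Measurable f) (hfb : ∀ z, f z ∈ Set.Icc 0 M)
    (φ : ℝ → ℝ) (hφ : IsDisutility φ)
    (L : ℝ) (hL : ∀ x y : ℝ, |φ x - φ y| ≤ L * |x - y|) :
    0 ≤ IOCE φ f P ∧ IOCE φ f P ≤ ∫ z, f z ∂P ∧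
      (∫ z, f z ∂P) ≤ OCE φ f P ∧ OCE φ f P ≤ L * ∫ z, f z ∂P := by
  obtain ⟨hmono, -, h0, hle⟩ := hφ
  have hfi : Integrable f P := Integrable.of_mem_Icc 0 M hf.aemeasurable (.of_forall hfb)
  have hcomp {g : Z → ℝ} (hg : Integrable g P) : Integrable (fun z => φ (g z)) P := by
    refine (hg.norm.const_mul L).mono' (hmono.measurable.comp_aemeasurable
      hg.aemeasurable).aestronglyMeasurable (.of_forall fun z => ?_)
    simpa [h0] using hL (g z) 0
  have hconst (c : ℝ) : Integrable (fun _ : Z => c) P := integrable_const c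
  have hO (c : ℝ) : ∫ z, f z ∂P ≤ c + ∫ z, φ (f z - c) ∂P := by
    have h := integral_mono (hfi.sub (hconst c)) (hcomp (hfi.sub (hconst c))) fun z => hle _
    simp only [Pi.sub_apply] at h
    rw [integral_sub hfi (hconst c)] at h
    simp only [integral_const, probReal_univ, one_smul] at h
    linarith
  have hI (c : ℝ) : c - ∫ z, φ (c - f z) ∂P ≤ ∫ z, f z ∂P := by
    have h := integral_mono ((hconst c).sub hfi) (hcomp ((hconst c).sub hfi)) fun z => hle _
    simp only [Pi.sub_apply] at h
    rw [integral_sub (hconst c) hfi] at h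
    simp only [integral_const, probReal_univ, one_smul] at h
    linarith
  refine ⟨?_, ciSup_le hI, le_ciInf hO, ?_⟩
  · refine le_ciSup_of_le ⟨_, forall_mem_range.2 hI⟩ 0 ?_
    have h : ∫ z, φ (0 - f z) ∂P ≤ 0 := integral_nonpos fun z =>
      (hmono (by linarith [(hfb z).1])).trans_eq h0
    linarith
  · refine ciInf_le_of_le ⟨_, forall_mem_range.2 hO⟩ 0 ?_
    simp only [sub_zero, zero_add]
    rw [← integral_const_mul]
    refine integral_mono (hcomp hfi) (hfi.const_mul L) fun z => ?_
    have h := (le_abs_self _).trans (hL (f z) 0)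
    simpa [h0, abs_of_nonneg (hfb z).1] using h
end

section
/- Let (Z, 𝒜, P) be a probability space, M > 0, f : Z → [0, M] measurable, and let φ : ℝ → ℝ be a disutility function that is Lipschitz with constant L. Write R(f) = ∫ f dP, σ²(f) = ∫ (f − R(f))² dP, σ(f) = √(σ²(f)), and C_φ = inf_{0 < |t| ≤ M} (φ(t) − t)/t², which is a nonnegative real number. Then C_φ·σ²(f) ≤ OCE_φ(f;P) − R(f) ≤ (L/2)·σ(f). -/
open MeasureTheory Finset Set ENNReal

/-- The excess `φ t - t` of a disutility function is monotone along rays from the origin. -/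
theorem IsDisutility.sub_id_mul_le {φ : ℝ → ℝ} (hφ : IsDisutility φ) {s t : ℝ}
    (hs : s ∈ Set.Icc (0 : ℝ) 1) : φ (s * t) - s * t ≤ φ t - t := by
  obtain ⟨-, hconv, h0, hle⟩ := hφ
  have h := hconv.2 (Set.mem_univ t) (Set.mem_univ 0) hs.1 (sub_nonneg.2 hs.2) (by ring)
  simp only [smul_eq_mul, mul_zero, add_zero, h0] at h
  nlinarith [mul_nonneg (sub_nonneg.2 hs.2) (sub_nonneg.2 (hle t))]

theorem IsDisutility.sub_id_le_of_nonneg {φ : ℝ → ℝ} (hφ : IsDisutility φ) {u t : ℝ}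
    (hu : 0 ≤ u) (hut : u ≤ t) : φ u - u ≤ φ t - t := by
  rcases (hu.trans hut).eq_or_lt with ht | ht
  · rw [show u = t by linarith]
  · simpa [div_mul_cancel₀ u ht.ne'] using
      hφ.sub_id_mul_le (t := t) ⟨div_nonneg hu ht.le, (div_le_one ht).2 hut⟩

theorem IsDisutility.sub_id_le_of_nonpos {φ : ℝ → ℝ} (hφ : IsDisutility φ) {u t : ℝ}
    (hu : u ≤ 0) (htu : t ≤ u) : φ u - u ≤ φ t - t := by
  rcases (htu.trans hu).eq_or_lt with ht | ht
  · rw [show u = t by linarith]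
  · simpa [div_mul_cancel₀ u ht.ne] using
      hφ.sub_id_mul_le (t := t) ⟨div_nonneg_of_nonpos hu ht.le, (div_le_one_of_neg ht).2 htu⟩

/-- Projecting `lam` onto an interval containing `x` decreases the excess at `x - lam`. -/
theorem IsDisutility.exists_mem_Icc_sub_id_le {φ : ℝ → ℝ} (hφ : IsDisutility φ) {a b : ℝ}
    (hab : a ≤ b) (lam : ℝ) : ∃ p ∈ Set.Icc a b, ∀ x ∈ Set.Icc a b,
      φ (x - p) - (x - p) ≤ φ (x - lam) - (x - lam) := by
  rcases le_total lam a with h | h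
  · exact ⟨a, ⟨le_rfl, hab⟩, fun x hx =>
      hφ.sub_id_le_of_nonneg (sub_nonneg.2 hx.1) (by linarith)⟩
  rcases le_total lam b with h' | h'
  · exact ⟨lam, ⟨h, h'⟩, fun x _ => le_rfl⟩
  · exact ⟨b, ⟨hab, le_rfl⟩, fun x hx =>
      hφ.sub_id_le_of_nonpos (sub_nonpos.2 hx.2) (by linarith)⟩

theorem IsDisutility.sub_id_le_of_lipschitz {φ : ℝ → ℝ} (hφ : IsDisutility φ) {L : ℝ}
    (hL : ∀ x y : ℝ, |φ x - φ y| ≤ L * |x - y|) (t : ℝ) :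
    φ t - t ≤ L / 2 * |t| + (L / 2 - 1) * t := by
  obtain ⟨hmono, -, h0, -⟩ := hφ
  rcases le_total 0 t with ht | ht
  · have h := (le_abs_self _).trans (hL t 0)
    rw [h0, sub_zero, sub_zero] at h
    rw [abs_of_nonneg ht] at *
    linarith
  · have h := hmono ht
    rw [abs_of_nonpos ht]
    linarith

/-- The integral is the best constant approximation in mean square. -/
theorem integral_sub_integral_sq_le {Z : Type*} [MeasurableSpace Z] {P : Measure Z}
    [IsProbabilityMeasure P] {f : Z → ℝ} (hf : MemLp f 2 P) (p : ℝ) :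
    ∫ z, (f z - ∫ w, f w ∂P) ^ 2 ∂P ≤ ∫ z, (f z - p) ^ 2 ∂P := by
  have hfi : Integrable f P := hf.integrable (by norm_num)
  set R := ∫ w, f w ∂P with hR
  have hsq : Integrable (fun z => (f z - R) ^ 2) P := (hf.sub (memLp_const R)).integrable_sq
  have hlin : Integrable (fun z => 2 * (R - p) * (f z - R)) P :=
    (hfi.sub (integrable_const R)).const_mul _
  have hexp : (fun z => (f z - p) ^ 2) =
      fun z => (f z - R) ^ 2 + 2 * (R - p) * (f z - R) + (R - p) ^ 2 := by
    funext z
    ring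
  rw [hexp, integral_add (f := fun z => (f z - R) ^ 2 + 2 * (R - p) * (f z - R))
    (hsq.add hlin) (integrable_const _), integral_add hsq hlin, integral_const_mul,
    integral_sub hfi (integrable_const R)]
  simp only [integral_const, probReal_univ, one_smul, ← hR, sub_self, mul_zero, add_zero]
  exact le_add_of_nonneg_right (sq_nonneg _)

theorem integral_abs_le_sqrt_integral_sq {Z : Type*} [MeasurableSpace Z] {P : Measure Z}
    [IsProbabilityMeasure P] {g : Z → ℝ} (hg : MemLp g 2 P) :
    ∫ z, |g z| ∂P ≤ Real.sqrt (∫ z, g z ^ 2 ∂P) := by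
  refine Real.le_sqrt_of_sq_le ?_
  have h := ProbabilityTheory.variance_nonneg |g| P
  rw [ProbabilityTheory.variance_eq_sub hg.abs] at h
  simpa using h

/-- variance-based characterization of the OCE risk:
with `C_φ = inf_{0<|t|≤M} (φ(t)−t)/t²` (a nonnegative real number),
`C_φ·σ²(f) ≤ OCE_φ(f;P) − R(f) ≤ (L/2)·σ(f)`. -/
theorem oce_variance_characterization {Z : Type*} [MeasurableSpace Z]
    (P : Measure Z) [IsProbabilityMeasure P] (M : ℝ) (hM : 0 < M)
    (f : Z → ℝ) (hf : Measurable f) (hfb : ∀ z, f z ∈ Set.Icc 0 M)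
    (φ : ℝ → ℝ) (hφ : IsDisutility φ)
    (L : ℝ) (hL : ∀ x y : ℝ, |φ x - φ y| ≤ L * |x - y|)
    (Cφ : ℝ) (hC : Cφ = sInf ((fun t : ℝ => (φ t - t) / t ^ 2) '' {t : ℝ | 0 < |t| ∧ |t| ≤ M})) :
    0 ≤ Cφ ∧
      Cφ * (∫ z, (f z - ∫ w, f w ∂P) ^ 2 ∂P) ≤ OCE φ f P - ∫ z, f z ∂P ∧
      OCE φ f P - (∫ z, f z ∂P) ≤ (L / 2) * Real.sqrt (∫ z, (f z - ∫ w, f w ∂P) ^ 2 ∂P) := by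
  have hmem : MemLp f 2 P := by
    refine MemLp.of_bound hf.aestronglyMeasurable M (ae_of_all _ fun z => ?_)
    rw [Real.norm_eq_abs, abs_of_nonneg (hfb z).1]
    exact (hfb z).2
  have hfi : Integrable f P := hmem.integrable (by norm_num)
  have hsub : ∀ lam : ℝ, MemLp (fun z => f z - lam) 2 P := fun lam => hmem.sub (memLp_const lam)
  have hsubi : ∀ lam : ℝ, Integrable (fun z => f z - lam) P := fun lam =>
    hfi.sub (integrable_const lam)
  have hφi : ∀ lam : ℝ, Integrable (fun z => φ (f z - lam)) P := fun lam => by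
    refine ((hsubi lam).abs.const_mul L).mono'
      (hφ.1.measurable.comp (hf.sub_const lam)).aestronglyMeasurable (ae_of_all _ fun z => ?_)
    simpa [hφ.2.2.1] using hL (f z - lam) 0
  have hexcess : ∀ lam : ℝ, lam + ∫ z, φ (f z - lam) ∂P - ∫ z, f z ∂P =
      ∫ z, (φ (f z - lam) - (f z - lam)) ∂P := fun lam => by
    rw [integral_sub (hφi lam) (hsubi lam), integral_sub hfi (integrable_const lam)]
    simp only [integral_const, probReal_univ, one_smul]
    ring
  have hlow : ∀ y ∈ (fun t : ℝ => (φ t - t) / t ^ 2) '' {t : ℝ | 0 < |t| ∧ |t| ≤ M}, 0 ≤ y := by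
    rintro _ ⟨t, -, rfl⟩
    exact div_nonneg (sub_nonneg.2 (hφ.2.2.2 t)) (sq_nonneg t)
  have hC0 : 0 ≤ Cφ := hC ▸ Real.sInf_nonneg hlow
  have hquad : ∀ t : ℝ, |t| ≤ M → Cφ * t ^ 2 ≤ φ t - t := fun t ht => by
    rcases eq_or_ne t 0 with rfl | h0
    · simp [hφ.2.2.1]
    · rw [← le_div_iff₀ (by positivity), hC]
      exact csInf_le ⟨0, hlow⟩ ⟨t, ⟨abs_pos.2 h0, ht⟩, rfl⟩
  have hlower : ∀ lam : ℝ, Cφ * (∫ z, (f z - ∫ w, f w ∂P) ^ 2 ∂P) + ∫ z, f z ∂P ≤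
      lam + ∫ z, φ (f z - lam) ∂P := fun lam => by
    obtain ⟨p, hp, hple⟩ := hφ.exists_mem_Icc_sub_id_le hM.le lam
    rw [← le_sub_iff_add_le, hexcess lam]
    calc Cφ * (∫ z, (f z - ∫ w, f w ∂P) ^ 2 ∂P)
        ≤ Cφ * ∫ z, (f z - p) ^ 2 ∂P :=
          mul_le_mul_of_nonneg_left (integral_sub_integral_sq_le hmem p) hC0
      _ = ∫ z, Cφ * (f z - p) ^ 2 ∂P := (integral_const_mul _ _).symm
      _ ≤ ∫ z, (φ (f z - lam) - (f z - lam)) ∂P := by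
          refine integral_mono ((hsub p).integrable_sq.const_mul Cφ)
            ((hφi lam).sub (hsubi lam)) fun z => ?_
          refine (hquad _ (abs_le.2 ⟨?_, ?_⟩)).trans (hple _ (hfb z))
          · linarith [(hfb z).1, hp.2]
          · linarith [(hfb z).2, hp.1]
  refine ⟨hC0, le_sub_iff_add_le.2 (le_ciInf hlower), ?_⟩
  have hL0 : 0 ≤ L := by
    simpa using (abs_nonneg _).trans (hL 1 0)
  set R := ∫ w, f w ∂P with hR
  calc OCE φ f P - R
      ≤ R + ∫ z, φ (f z - R) ∂P - R :=
        sub_le_sub_right (ciInf_le ⟨_, Set.forall_mem_range.2 hlower⟩ R) R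
    _ = ∫ z, (φ (f z - R) - (f z - R)) ∂P := hexcess R
    _ ≤ ∫ z, (L / 2 * |f z - R| + (L / 2 - 1) * (f z - R)) ∂P :=
        integral_mono ((hφi R).sub (hsubi R))
          (((hsubi R).abs.const_mul _).add ((hsubi R).const_mul _))
          fun z => hφ.sub_id_le_of_lipschitz hL _
    _ = L / 2 * ∫ z, |f z - R| ∂P := by
        rw [integral_add ((hsubi R).abs.const_mul _) ((hsubi R).const_mul _),
          integral_const_mul, integral_const_mul, integral_sub hfi (integrable_const R)]
        simp [← hR]
    _ ≤ L / 2 * Real.sqrt (∫ z, (f z - R) ^ 2 ∂P) :=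
        mul_le_mul_of_nonneg_left (integral_abs_le_sqrt_integral_sq (hsub R)) (by linarith)
end

section
/- Let (Z, 𝒜, P) be a probability space, M > 0, f : Z → ℝ measurable with 0 ≤ f(z) ≤ M for P-almost every z, and let φ : ℝ → ℝ be a disutility function. Then the map λ ↦ λ + ∫ φ(f(z) − λ) dP(z) attains its infimum over ℝ at some point of the interval [0, M], so that OCE_φ(f;P) = min_{λ ∈ [0,M]} ( λ + ∫ φ(f(z) − λ) dP(z) ); similarly, the map λ ↦ λ − ∫ φ(λ − f(z)) dP(z) attains its supremum over ℝ at some point of [0, M], so that IOCE_φ(f;P) = max_{λ ∈ [0,M]} ( λ − ∫ φ(λ − f(z)) dP(z) ). -/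
open MeasureTheory Finset Set ENNReal

namespace IsDisutility

variable {φ : ℝ → ℝ}

/-- A disutility function is nearest to the identity close to `0`: the gap `φ(t) − t` does not
decrease when `t` moves away from `0`. -/
lemma sub_self_le (hφ : IsDisutility φ) {a t : ℝ} (ha : a ∈ Set.Icc (0 : ℝ) 1) :
    φ (a * t) - a * t ≤ φ t - t := by
  obtain ⟨-, hconv, h0, hle⟩ := hφ
  have h := hconv.2 (Set.mem_univ t) (Set.mem_univ 0) ha.1 (sub_nonneg.2 ha.2) (by ring)
  simp only [smul_eq_mul, mul_zero, add_zero, h0] at h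
  nlinarith [mul_le_mul_of_nonneg_left (hle t) (sub_nonneg.2 ha.2)]

lemma sub_le_of_nonneg (hφ : IsDisutility φ) {s t : ℝ} (hs : 0 ≤ s) (hst : s ≤ t) :
    φ s - s ≤ φ t - t := by
  obtain rfl | ht := (hs.trans hst).eq_or_lt
  · rw [le_antisymm hst hs]
  · have h := hφ.sub_self_le (t := t) ⟨div_nonneg hs ht.le, div_le_one_of_le₀ hst ht.le⟩
    rwa [div_mul_cancel₀ _ ht.ne'] at h

lemma sub_le_of_nonpos (hφ : IsDisutility φ) {s t : ℝ} (ht : t ≤ 0) (hst : s ≤ t) :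
    φ t - t ≤ φ s - s := by
  obtain rfl | hs := (hst.trans ht).eq_or_lt
  · rw [le_antisymm ht hst]
  · have h := hφ.sub_self_le (t := s) ⟨div_nonneg_of_nonpos ht hs.le, (div_le_one_of_neg hs).2 hst⟩
    rwa [div_mul_cancel₀ _ hs.ne] at h

lemma continuous (hφ : IsDisutility φ) : Continuous φ :=
  continuousOn_univ.1 (hφ.2.1.continuousOn isOpen_univ)

variable {Z : Type*} [MeasurableSpace Z] {P : Measure Z} {M : ℝ} {f : Z → ℝ}

lemma integrable_comp_sub [IsFiniteMeasure P] (hφ : IsDisutility φ) (hf : Measurable f)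
    (hfb : ∀ᵐ z ∂P, f z ∈ Set.Icc 0 M) (lam : ℝ) : Integrable (fun z => φ (f z - lam)) P := by
  refine Integrable.of_mem_Icc (φ (0 - lam)) (φ (M - lam))
    (hφ.continuous.measurable.comp (hf.sub_const lam)).aemeasurable ?_
  filter_upwards [hfb] with z hz
  exact ⟨hφ.1 (sub_le_sub_right hz.1 lam), hφ.1 (sub_le_sub_right hz.2 lam)⟩

lemma continuousOn_integral_comp_sub [IsFiniteMeasure P] (hφ : IsDisutility φ) (hf : Measurable f)
    (hfb : ∀ᵐ z ∂P, f z ∈ Set.Icc 0 M) :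
    ContinuousOn (fun lam => ∫ z, φ (f z - lam) ∂P) (Set.Icc 0 M) := by
  refine continuousOn_of_dominated (bound := fun _ => max |φ (-M)| |φ M|)
    (fun lam _ => (hφ.integrable_comp_sub hf hfb lam).aestronglyMeasurable) ?_
    (integrable_const _) ?_
  · intro lam hlam
    filter_upwards [hfb] with z hz
    exact abs_le_max_abs_abs (hφ.1 (by linarith [hz.1, hlam.2])) (hφ.1 (by linarith [hz.2, hlam.1]))
  · exact Filter.Eventually.of_forall fun z =>
      (hφ.continuous.comp (continuous_const.sub continuous_id)).continuousOn

lemma add_integral_le_of_ae_le [IsProbabilityMeasure P] {lam mu : ℝ}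
    (hlam : Integrable (fun z => φ (f z - lam)) P) (hmu : Integrable (fun z => φ (f z - mu)) P)
    (h : ∀ᵐ z ∂P, φ (f z - lam) - (f z - lam) ≤ φ (f z - mu) - (f z - mu)) :
    lam + ∫ z, φ (f z - lam) ∂P ≤ mu + ∫ z, φ (f z - mu) ∂P := by
  have key : ∫ z, φ (f z - lam) ∂P ≤ ∫ z, (φ (f z - mu) + (mu - lam)) ∂P := by
    refine integral_mono_ae hlam (hmu.add (integrable_const _)) ?_
    filter_upwards [h] with z hz
    linarith
  rw [integral_add hmu (integrable_const _), integral_const, probReal_univ, one_smul] at key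
  linarith

/-- The OCE objective of a loss with values in `[0, M]` has a global minimiser in `[0, M]`. -/
lemma exists_forall_add_integral_le [IsProbabilityMeasure P] (hφ : IsDisutility φ) (hM : 0 ≤ M)
    (hf : Measurable f) (hfb : ∀ᵐ z ∂P, f z ∈ Set.Icc 0 M) :
    ∃ lam₀ ∈ Set.Icc (0 : ℝ) M,
      ∀ lam : ℝ, lam₀ + ∫ z, φ (f z - lam₀) ∂P ≤ lam + ∫ z, φ (f z - lam) ∂P := by
  obtain ⟨lam₀, hmem, hmin⟩ := isCompact_Icc.exists_isMinOn (Set.nonempty_Icc.2 hM)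
    (f := fun lam => lam + ∫ z, φ (f z - lam) ∂P)
    (continuousOn_id.add (hφ.continuousOn_integral_comp_sub hf hfb))
  have hint := hφ.integrable_comp_sub hf hfb
  refine ⟨lam₀, hmem, fun lam => ?_⟩
  rcases lt_or_ge lam 0 with hneg | hnonneg
  · refine (isMinOn_iff.1 hmin 0 (Set.left_mem_Icc.2 hM)).trans
      (add_integral_le_of_ae_le (hint 0) (hint lam) ?_)
    filter_upwards [hfb] with z hz
    exact hφ.sub_le_of_nonneg (by linarith [hz.1]) (by linarith)
  rcases le_or_gt lam M with hle | hgt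
  · exact isMinOn_iff.1 hmin lam ⟨hnonneg, hle⟩
  · refine (isMinOn_iff.1 hmin M (Set.right_mem_Icc.2 hM)).trans
      (add_integral_le_of_ae_le (hint M) (hint lam) ?_)
    filter_upwards [hfb] with z hz
    exact hφ.sub_le_of_nonpos (by linarith [hz.2]) (by linarith)

end IsDisutility

/-- the variational parameter `λ` in the OCE (resp. inverted OCE) of a loss
taking values in `[0,M]` (almost surely) can be restricted to `[0,M]`: the infimum (resp.
supremum) over `ℝ` is attained at some point of `[0,M]`. -/
theorem oce_search_space {Z : Type*} [MeasurableSpace Z]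
    (P : Measure Z) [IsProbabilityMeasure P] (M : ℝ) (hM : 0 < M)
    (f : Z → ℝ) (hf : Measurable f) (hfb : ∀ᵐ z ∂P, f z ∈ Set.Icc 0 M)
    (φ : ℝ → ℝ) (hφ : IsDisutility φ) :
    (∃ lam₀ ∈ Set.Icc (0 : ℝ) M,
      (∀ lam : ℝ, lam₀ + ∫ z, φ (f z - lam₀) ∂P ≤ lam + ∫ z, φ (f z - lam) ∂P) ∧
      OCE φ f P = lam₀ + ∫ z, φ (f z - lam₀) ∂P) ∧
    (∃ lam₁ ∈ Set.Icc (0 : ℝ) M,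
      (∀ lam : ℝ, lam - ∫ z, φ (lam - f z) ∂P ≤ lam₁ - ∫ z, φ (lam₁ - f z) ∂P) ∧
      IOCE φ f P = lam₁ - ∫ z, φ (lam₁ - f z) ∂P) := by
  obtain ⟨lam₀, hmem₀, hmin₀⟩ := hφ.exists_forall_add_integral_le hM.le hf hfb
  obtain ⟨mu, hmu, hmin₁⟩ := hφ.exists_forall_add_integral_le (f := fun z => M - f z) (P := P)
    hM.le (measurable_const.sub hf) (by
      filter_upwards [hfb] with z hz
      exact ⟨sub_nonneg.2 hz.2, sub_le_self M hz.1⟩)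
  have hmax : ∀ lam : ℝ, lam - ∫ z, φ (lam - f z) ∂P ≤
      (M - mu) - ∫ z, φ (M - mu - f z) ∂P := by
    intro lam
    have h := hmin₁ (M - lam)
    have e₁ : ∀ z, M - f z - mu = M - mu - f z := fun z => by ring
    have e₂ : ∀ z, M - f z - (M - lam) = lam - f z := fun z => by ring
    simp only [e₁, e₂] at h
    linarith
  refine ⟨⟨lam₀, hmem₀, hmin₀, ?_⟩,
    ⟨M - mu, ⟨sub_nonneg.2 hmu.2, sub_le_self M hmu.1⟩, hmax, ?_⟩⟩
  · exact le_antisymm (ciInf_le ⟨_, Set.forall_mem_range.2 hmin₀⟩ lam₀) (le_ciInf hmin₀)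
  · exact le_antisymm (ciSup_le hmax) (le_ciSup (f := fun lam => lam - ∫ z, φ (lam - f z) ∂P)
      ⟨_, Set.forall_mem_range.2 hmax⟩ (M - mu))
end

section
/- For all real numbers p ∈ (0,1) and q ∈ (1/2, 3/4), the binary Kullback–Leibler divergence satisfies p·log(p/q) + (1−p)·log((1−p)/(1−q)) ≤ 8·(p − q)². -/
/-- The binary KL divergence is at most the binary chi-squared divergence. -/
theorem binary_kl_le_chi_sq {p q : ℝ} (hp : p ∈ Set.Ioo (0 : ℝ) 1) (hq : q ∈ Set.Ioo (0 : ℝ) 1) :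
    p * Real.log (p / q) + (1 - p) * Real.log ((1 - p) / (1 - q)) ≤
      (p - q) ^ 2 / (q * (1 - q)) := by
  obtain ⟨hp0, hp1⟩ := hp
  obtain ⟨hq0, hq1⟩ := hq
  have hp' : 0 < 1 - p := sub_pos.2 hp1
  have hq' : 0 < 1 - q := sub_pos.2 hq1
  calc p * Real.log (p / q) + (1 - p) * Real.log ((1 - p) / (1 - q))
      ≤ p * (p / q - 1) + (1 - p) * ((1 - p) / (1 - q) - 1) := by
        gcongr
        · exact Real.log_le_sub_one_of_pos (div_pos hp0 hq0)
        · exact Real.log_le_sub_one_of_pos (div_pos hp' hq')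
    _ = (p - q) ^ 2 / (q * (1 - q)) := by
        field_simp
        ring

/-- quadratic upper bound on the binary KL divergence:
for `p ∈ (0,1)` and `q ∈ (1/2, 3/4)`, `bkl(p‖q) ≤ 8(p − q)²`. -/
theorem binary_kl_le (p q : ℝ) (hp : p ∈ Set.Ioo (0 : ℝ) 1)
    (hq : q ∈ Set.Ioo (1 / 2 : ℝ) (3 / 4)) :
    p * Real.log (p / q) + (1 - p) * Real.log ((1 - p) / (1 - q)) ≤ 8 * (p - q) ^ 2 := by
  obtain ⟨hq1, hq2⟩ := hq
  have hq_var : 1 / 8 ≤ q * (1 - q) := by nlinarith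
  refine (binary_kl_le_chi_sq hp ⟨by linarith, by linarith⟩).trans ?_
  rw [div_le_iff₀ (by linarith)]
  nlinarith [mul_le_mul_of_nonneg_left hq_var (sq_nonneg (p - q))]
end
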